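/- Let |ψ⟩ be a fully entangled stabilizer state on n ≥ 3 qubits such that for every qubit i ∈ {1,…,n} and every Pauli matrix σ_u with u ∈ {x,y,z}, there exists an element of the subgroup ℳ(ψ) generated by the minimal elements of 𝒮(ψ) whose i-th tensor factor equals σ_u. Then LU(ψ) = LC(ψ), i.e., every stabilizer state that is local-unitary equivalent to |ψ⟩ is also local-Clifford equivalent to |ψ⟩. -/

import Mathlib

open Matrix

noncomputable section

/-- Pauli matrices: `0 ↦ σ₀` (identity), `1 ↦ σₓ`, `2 ↦ σ_y`, `3 ↦ σ_z`. -/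
def pauliMat : Fin 4 → Matrix (Fin 2) (Fin 2) ℂ :=
  ![1, !![0, 1; 1, 0], !![0, -Complex.I; Complex.I, 0], !![1, 0; 0, -1]]

/-- Tensor (Kronecker) product of a family of one-qubit operators, as an operator
on qubits indexed by `ι`. -/
def kron {ι : Type} [Fintype ι] (U : ι → Matrix (Fin 2) (Fin 2) ℂ) :
    Matrix (ι → Fin 2) (ι → Fin 2) ℂ :=
  Matrix.of fun x y => ∏ i, U i (x i) (y i)

/-- An element of the Pauli group: a phase in `{1, -1, i, -i}` together with a
Pauli label (`σ₀, σₓ, σ_y, σ_z`) on every qubit. -/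
structure PauliOp (ι : Type) where
  phase : ℂ
  label : ι → Fin 4
  phase_ok : phase = 1 ∨ phase = -1 ∨ phase = Complex.I ∨ phase = -Complex.I

noncomputable instance {ι : Type} : DecidableEq (PauliOp ι) := Classical.decEq _

/-- The matrix of a Pauli group element. -/
def PauliOp.toMatrix {ι : Type} [Fintype ι] (M : PauliOp ι) :
    Matrix (ι → Fin 2) (ι → Fin 2) ℂ :=
  M.phase • kron fun i => pauliMat (M.label i)

/-- The support of a Pauli operator: the set of qubits on which it acts nontrivially. -/
def PauliOp.support {ι : Type} [Fintype ι] [DecidableEq ι] (M : PauliOp ι) : Finset ι :=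
  Finset.univ.filter fun i => M.label i ≠ 0

/-- A (maximal) stabilizer on the qubits indexed by `ι`: an abelian subgroup of the
Pauli group of cardinality `2^|ι|` which does not contain `-I`. -/
structure Stabilizer (ι : Type) [Fintype ι] [DecidableEq ι] where
  elems : Finset (PauliOp ι)
  one_mem : ∃ M ∈ elems, PauliOp.toMatrix M = 1
  mul_mem : ∀ M ∈ elems, ∀ N ∈ elems, ∃ K ∈ elems,
    PauliOp.toMatrix K = PauliOp.toMatrix M * PauliOp.toMatrix N
  comm : ∀ M ∈ elems, ∀ N ∈ elems,
    PauliOp.toMatrix M * PauliOp.toMatrix N = PauliOp.toMatrix N * PauliOp.toMatrix M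
  neg_one_not_mem : ∀ M ∈ elems, PauliOp.toMatrix M ≠ -1
  card_elems : elems.card = 2 ^ Fintype.card ι

variable {ι : Type} [Fintype ι] [DecidableEq ι]

/-- `ψ` is the stabilizer state of the stabilizer `S`: it is a unit vector fixed by
every element of `S`. -/
def stabilizesState (S : Stabilizer ι) (ψ : (ι → Fin 2) → ℂ) : Prop :=
  (∑ x, Complex.normSq (ψ x)) = 1 ∧ ∀ M ∈ S.elems, (PauliOp.toMatrix M).mulVec ψ = ψ

/-- `ψ` is a stabilizer state. -/
def IsStabilizerState (ψ : (ι → Fin 2) → ℂ) : Prop :=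
  ∃ S : Stabilizer ι, stabilizesState S ψ

/-- `A_ω(ψ)`: the number of stabilizer elements with support exactly `ω`. -/
def Aomega (S : Stabilizer ι) (ω : Finset ι) : ℕ :=
  (S.elems.filter fun M => PauliOp.support M = ω).card

/-- `ω` is a minimal support of `S`: it is the support of some element of `S`, and no
element of `S` has nonempty support strictly contained in `ω`. -/
def IsMinimalSupport (S : Stabilizer ι) (ω : Finset ι) : Prop :=
  (∃ M ∈ S.elems, PauliOp.support M = ω) ∧
    ∀ M ∈ S.elems, PauliOp.support M ⊂ ω → PauliOp.support M = ∅

/-- The matrices of the minimal elements of `S` (the elements whose support is a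
minimal support). -/
def minimalMatrices (S : Stabilizer ι) : Set (Matrix (ι → Fin 2) (ι → Fin 2) ℂ) :=
  {A | ∃ M ∈ S.elems, IsMinimalSupport S (PauliOp.support M) ∧ PauliOp.toMatrix M = A}

/-- `M` belongs to the subgroup `ℳ(ψ)` of `S` generated by the minimal elements.
(Every stabilizer element is an involution, so the generated submonoid coincides with
the generated subgroup.) -/
def inMinimalSubgroup (S : Stabilizer ι) (M : PauliOp ι) : Prop :=
  M ∈ S.elems ∧ PauliOp.toMatrix M ∈ Submonoid.closure (minimalMatrices S)

/-- A one-qubit Clifford operation: a unitary mapping each of the three Pauli matrices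
to a Pauli matrix, up to sign, under conjugation. -/
def IsClifford (U : Matrix (Fin 2) (Fin 2) ℂ) : Prop :=
  U ∈ Matrix.unitaryGroup (Fin 2) ℂ ∧
    ∃ π : Equiv.Perm (Fin 3), ∀ u : Fin 3, ∃ s : ℂ, (s = 1 ∨ s = -1) ∧
      U * pauliMat u.succ * Uᴴ = s • pauliMat (π u).succ

/-- Local unitary equivalence of pure states. -/
def LUequiv (ψ φ : (ι → Fin 2) → ℂ) : Prop :=
  ∃ U : ι → Matrix (Fin 2) (Fin 2) ℂ,
    (∀ i, U i ∈ Matrix.unitaryGroup (Fin 2) ℂ) ∧ (kron U).mulVec ψ = φ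

/-- Local Clifford equivalence of pure states. -/
def LCequiv (ψ φ : (ι → Fin 2) → ℂ) : Prop :=
  ∃ U : ι → Matrix (Fin 2) (Fin 2) ℂ,
    (∀ i, IsClifford (U i)) ∧ (kron U).mulVec ψ = φ

/-- Local Clifford equivalence of (possibly mixed) states. -/
def LCequivMixed (ρ ρ' : Matrix (ι → Fin 2) (ι → Fin 2) ℂ) : Prop :=
  ∃ U : ι → Matrix (Fin 2) (Fin 2) ℂ,
    (∀ i, IsClifford (U i)) ∧ kron U * ρ * (kron U)ᴴ = ρ'

/-- A pure state is fully entangled if it is not a tensor product of states on two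
complementary nonempty subsets of the qubits. -/
def FullyEntangled (ψ : (ι → Fin 2) → ℂ) : Prop :=
  ¬ ∃ (ω : Finset ι) (φ : ({i // i ∈ ω} → Fin 2) → ℂ) (χ : ({i // i ∉ ω} → Fin 2) → ℂ),
      ω ≠ ∅ ∧ ω ≠ Finset.univ ∧
        ∀ x : ι → Fin 2, ψ x = φ (fun i => x i.1) * χ (fun i => x i.1)

/-- Recombine an assignment on `ω` and one on its complement into a global assignment. -/
def mergeAssign (ω : Finset ι) (x : {i // i ∈ ω} → Fin 2) (z : {i // i ∉ ω} → Fin 2) :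
    ι → Fin 2 :=
  fun i => if h : i ∈ ω then x ⟨i, h⟩ else z ⟨i, h⟩

/-- The reduced density matrix `ρ_ω(ψ)` of the pure state `ψ` on the qubits in `ω`
(partial trace of `|ψ⟩⟨ψ|` over the qubits outside `ω`). -/
def reducedState (ψ : (ι → Fin 2) → ℂ) (ω : Finset ι) :
    Matrix ({i // i ∈ ω} → Fin 2) ({i // i ∈ ω} → Fin 2) ℂ :=
  Matrix.of fun x y =>
    ∑ z : {i // i ∉ ω} → Fin 2, ψ (mergeAssign ω x z) * (starRingEnd ℂ) (ψ (mergeAssign ω y z))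

/-- The restriction `α_M M_{i₁} ⊗ ⋯ ⊗ M_{i_k}` of a Pauli operator to the qubits in `ω`. -/
def PauliOp.restrict (M : PauliOp ι) (ω : Finset ι) :
    Matrix ({i // i ∈ ω} → Fin 2) ({i // i ∈ ω} → Fin 2) ℂ :=
  M.phase • kron fun i : {i // i ∈ ω} => pauliMat (M.label i.1)

/-- The `n`-qubit GHZ state `(|0…0⟩ + |1…1⟩)/√2`. -/
def ghz (n : ℕ) : (Fin n → Fin 2) → ℂ :=
  fun x => if x = (fun _ => 0) ∨ x = (fun _ => 1) then ((Real.sqrt 2 : ℝ)⁻¹ : ℂ) else 0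

/-- The `2n × 2n` binary symplectic form `P = [[0, I], [I, 0]]`. -/
def Pmat (n : ℕ) : Matrix (Fin n ⊕ Fin n) (Fin n ⊕ Fin n) (ZMod 2) :=
  Matrix.fromBlocks 0 1 1 0

end

section

variable {ι : Type} [Fintype ι] [DecidableEq ι]

/-- The label of the product of two Pauli matrices, up to phase. -/
def labelMul : Fin 4 → Fin 4 → Fin 4 :=
  ![![0, 1, 2, 3], ![1, 0, 3, 2], ![2, 3, 0, 1], ![3, 2, 1, 0]]

lemma labelMul_eq_zero {a b : Fin 4} : labelMul a b = 0 ↔ a = b := by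
  revert a b; decide

/-- The qubits on which a Pauli label is nontrivial. -/
def labelSupport (a : ι → Fin 4) : Finset ι :=
  Finset.univ.filter fun i => a i ≠ 0

omit [DecidableEq ι] in
@[simp] lemma mem_labelSupport {a : ι → Fin 4} {i : ι} : i ∈ labelSupport a ↔ a i ≠ 0 := by
  simp [labelSupport]

omit [DecidableEq ι] in
lemma labelSupport_eq_empty {a : ι → Fin 4} (h : labelSupport a = ∅) (i : ι) : a i = 0 := by
  by_contra h1
  have : i ∈ labelSupport a := mem_labelSupport.2 h1
  simp [h] at this

lemma labelSupport_labelMul_subset {a b : ι → Fin 4} {ω : Finset ι}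
    (ha : labelSupport a ⊆ ω) (hb : labelSupport b ⊆ ω) :
    labelSupport (fun i => labelMul (a i) (b i)) ⊆ ω := by
  intro i hi
  rw [mem_labelSupport] at hi
  by_contra hω
  have h1 : a i = 0 := by
    by_contra h; exact hω (ha (mem_labelSupport.2 h))
  have h2 : b i = 0 := by
    by_contra h; exact hω (hb (mem_labelSupport.2 h))
  rw [h1, h2] at hi
  exact hi rfl

lemma sum_prod_eq_prod_sum {κ R : Type} [Fintype κ] [CommSemiring R] (f : ι → κ → R) :
    ∑ b : ι → κ, ∏ i, f i (b i) = ∏ i, ∑ k, f i k := by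
  rw [Finset.prod_univ_sum]; simp

/-- The elements of a group of labels with a given minimal support are determined by their value at
one qubit of that support. -/
lemma eq_of_eq_at {c : (ι → Fin 4) → ℝ}
    (hmul : ∀ a b, c a ≠ 0 → c b ≠ 0 → c (fun i => labelMul (a i) (b i)) ≠ 0)
    {ω : Finset ι} (hω : ∀ a, c a ≠ 0 → labelSupport a ⊂ ω → labelSupport a = ∅)
    {a b : ι → Fin 4} (ha : c a ≠ 0) (hb : c b ≠ 0) (hsa : labelSupport a ⊆ ω)
    (hsb : labelSupport b ⊆ ω) {i : ι} (hi : i ∈ ω) (hab : a i = b i) : a = b := by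
  have h1 := hω _ (hmul a b ha hb) ((Finset.ssubset_iff_of_subset
    (labelSupport_labelMul_subset hsa hsb)).2 ⟨i, hi, by simp [labelMul_eq_zero, hab]⟩)
  funext j
  exact labelMul_eq_zero.1 (labelSupport_eq_empty h1 j)

lemma card_le_sum_sq {c : (ι → Fin 4) → ℝ} (hval : ∀ a, c a = 0 ∨ |c a| = 1) {ω : Finset ι}
    (T : Finset (ι → Fin 4)) (hT : ∀ a ∈ T, c a ≠ 0 ∧ labelSupport a ⊆ ω) :
    (T.card : ℝ) ≤ ∑ a with labelSupport a ⊆ ω, c a ^ 2 := by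
  calc (T.card : ℝ) = ∑ a ∈ T, c a ^ 2 := by
        rw [Finset.card_eq_sum_ones, Nat.cast_sum]
        refine Finset.sum_congr rfl fun a ha => ?_
        rw [← sq_abs, (hval a).resolve_left (hT a ha).1]; simp
    _ ≤ _ := Finset.sum_le_sum_of_subset_of_nonneg
        (fun a ha => by simpa using (hT a ha).2) fun _ _ _ => sq_nonneg _

/-- Transport by the transposed maps on all qubits but one. -/
lemma partial_transpose {R : ι → Fin 4 → Fin 4 → ℝ} {c c' : (ι → Fin 4) → ℝ}
    (hcol : ∀ i α α', ∑ β, R i β α * R i β α' = if α = α' then 1 else 0)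
    (htrans : ∀ b, c' b = ∑ a, (∏ i, R i (b i) (a i)) * c a)
    (a : ι → Fin 4) (i : ι) (β : Fin 4) :
    ∑ b : ι → Fin 4, (if b i = β then (∏ m ∈ Finset.univ.erase i, R m (b m) (a m)) * c' b else 0)
      = ∑ α, R i β α * c (Function.update a i α) := by
  have key : ∀ a' : ι → Fin 4, ∑ b : ι → Fin 4, ∏ m,
      ((if m = i then (if b m = β then 1 else 0) else R m (b m) (a m)) * R m (b m) (a' m))
      = if a' = Function.update a i (a' i) then R i β (a' i) else 0 := by
    intro a'
    rw [sum_prod_eq_prod_sum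
      (fun m γ => (if m = i then (if γ = β then (1 : ℝ) else 0) else R m γ (a m)) * R m γ (a' m)),
      ← Finset.mul_prod_erase _ _ (Finset.mem_univ i)]
    have h2 : ∏ m ∈ Finset.univ.erase i, ∑ γ, (if m = i then (if γ = β then (1 : ℝ) else 0)
        else R m γ (a m)) * R m γ (a' m)
        = ∏ m ∈ Finset.univ.erase i, if a m = a' m then (1 : ℝ) else 0 := by
      refine Finset.prod_congr rfl fun m hm => ?_
      simp only [(Finset.mem_erase.1 hm).1, if_false, hcol]
    rw [h2, Finset.prod_boole]
    have h3 : (∀ m ∈ Finset.univ.erase i, a m = a' m) ↔ a' = Function.update a i (a' i) := by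
      rw [Function.eq_update_iff]
      simp [eq_comm]
    simp only [h3]
    simp
  have h1 : ∀ b : ι → Fin 4,
      (if b i = β then (∏ m ∈ Finset.univ.erase i, R m (b m) (a m)) * c' b else 0)
      = ∑ a', (∏ m, ((if m = i then (if b m = β then 1 else 0) else R m (b m) (a m))
          * R m (b m) (a' m))) * c a' := by
    intro b
    have h4 : ∏ m, (if m = i then (if b m = β then (1 : ℝ) else 0) else R m (b m) (a m))
        = if b i = β then ∏ m ∈ Finset.univ.erase i, R m (b m) (a m) else 0 := by
      rw [← Finset.mul_prod_erase _ _ (Finset.mem_univ i)]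
      have : ∏ m ∈ Finset.univ.erase i,
          (if m = i then (if b m = β then (1 : ℝ) else 0) else R m (b m) (a m))
          = ∏ m ∈ Finset.univ.erase i, R m (b m) (a m) :=
        Finset.prod_congr rfl fun m hm => by simp only [(Finset.mem_erase.1 hm).1, if_false]
      rw [this, if_pos rfl, ite_mul, one_mul, zero_mul]
    simp only [Finset.prod_mul_distrib, h4, mul_assoc, ← Finset.mul_sum, ← htrans]
    simp only [ite_mul, zero_mul]
  rw [Finset.sum_congr rfl fun b _ => h1 b, Finset.sum_comm]
  simp only [← Finset.sum_mul, key]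
  simp only [ite_mul, zero_mul]
  rw [← Finset.sum_filter]
  symm
  refine Finset.sum_bij (fun α _ => Function.update a i α) ?_ ?_ ?_ ?_
  · intro α _; simp
  · intro α _ α' _ h
    simpa using congrFun h i
  · intro a' ha'
    exact ⟨a' i, Finset.mem_univ _, (Finset.mem_filter.1 ha').2.symm⟩
  · intro α _; simp

/-- Local rotations carrying one group of labels to another act as signed permutations on the
labels of minimal support. -/
theorem eq_zero_or_abs_eq_one_of_minimal (hcard : 3 ≤ Fintype.card ι)
    {R : ι → Fin 4 → Fin 4 → ℝ} {c c' : (ι → Fin 4) → ℝ}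
    (hcol : ∀ i α α', ∑ β, R i β α * R i β α' = if α = α' then 1 else 0)
    (h00 : ∀ i, R i 0 0 = 1) (hr0 : ∀ i β, β ≠ 0 → R i β 0 = 0)
    (h0r : ∀ i α, α ≠ 0 → R i 0 α = 0)
    (htrans : ∀ b, c' b = ∑ a, (∏ i, R i (b i) (a i)) * c a)
    (hval : ∀ a, c a = 0 ∨ |c a| = 1) (hval' : ∀ b, c' b = 0 ∨ |c' b| = 1)
    (hmul : ∀ a b, c a ≠ 0 → c b ≠ 0 → c (fun i => labelMul (a i) (b i)) ≠ 0)
    (hmul' : ∀ a b, c' a ≠ 0 → c' b ≠ 0 → c' (fun i => labelMul (a i) (b i)) ≠ 0)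
    (hent : ∀ ω : Finset ι, ω ≠ ∅ → ω ≠ Finset.univ →
      ∑ a with labelSupport a ⊆ ω, c a ^ 2 < 2 ^ ω.card)
    {a : ι → Fin 4} (ha : c a ≠ 0)
    (hmin : ∀ a', c a' ≠ 0 → labelSupport a' ⊂ labelSupport a → labelSupport a' = ∅)
    {i : ι} (hi : a i ≠ 0) (β : Fin 4) : R i β (a i) = 0 ∨ |R i β (a i)| = 1 := by
  have hR : ∀ i α β, R i β α ≠ 0 → (β ≠ 0 ↔ α ≠ 0) := by
    intro i α β h
    constructor
    · rintro h1 rfl; exact h (hr0 i β h1)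
    · rintro h1 rfl; exact h (h0r i α h1)
  have hzero : c (fun _ => 0) ≠ 0 := by
    have := hmul a a ha ha
    simpa [labelMul_eq_zero.2 rfl] using this
  have hsupp0 : labelSupport (fun _ : ι => (0 : Fin 4)) = ∅ := by simp [labelSupport]
  have hcu : ∀ ω : Finset ι, ω.card ≤ 2 → ω ≠ Finset.univ := by
    rintro ω h rfl
    rw [Finset.card_univ] at h
    omega
  -- no label is supported on a single qubit
  have hsingle : ∀ d (j : ι), c d ≠ 0 → labelSupport d = {j} → False := by
    intro d j hd hs
    have hd0 : (fun _ => 0) ≠ d := by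
      rintro rfl
      rw [hsupp0] at hs
      exact Finset.singleton_ne_empty _ hs.symm
    have h1 := card_le_sum_sq hval (ω := {j}) {fun _ => 0, d} (by
      simp [hzero, hd, hsupp0, hs])
    have h2 := hent {j} (by simp) (hcu _ (by simp))
    rw [Finset.card_pair hd0] at h1
    norm_num at h1 h2
    linarith
  have hex : ∀ b, c' b ≠ 0 → ∃ a', c a' ≠ 0 ∧ labelSupport a' = labelSupport b := by
    intro b hb
    rw [htrans] at hb
    obtain ⟨a', -, h⟩ := Finset.exists_ne_zero_of_sum_ne_zero hb
    refine ⟨a', right_ne_zero_of_mul h, ?_⟩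
    ext m
    rw [mem_labelSupport, mem_labelSupport]
    exact (hR m _ _ (Finset.prod_ne_zero_iff.1 (left_ne_zero_of_mul h) m (Finset.mem_univ m))).symm
  have hmin' : ∀ b, c' b ≠ 0 → labelSupport b ⊂ labelSupport a → labelSupport b = ∅ := by
    intro b hb hs
    obtain ⟨a', ha', hs'⟩ := hex b hb
    rw [← hs'] at hs ⊢
    exact hmin a' ha' hs
  have hrel : ∀ j β, a j ≠ 0 → β ≠ 0 → R j β (a j) * c a = ∑ b : ι → Fin 4,
      (if b j = β then (∏ m ∈ Finset.univ.erase j, R m (b m) (a m)) * c' b else 0) := by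
    intro j β hj hβ
    rw [partial_transpose hcol htrans, Finset.sum_eq_single (a j)]
    · simp
    · intro α _ hα
      by_contra hne
      have h2 := hmul a _ ha (right_ne_zero_of_mul hne)
      refine hsingle _ j h2 ?_
      ext m
      rw [mem_labelSupport, Ne, labelMul_eq_zero, Finset.mem_singleton]
      by_cases hm : m = j
      · subst hm; simpa using hα.symm
      · simp [hm]
    · simp
  have hterm : ∀ j b, a j ≠ 0 → b j ≠ 0 →
      (∏ m ∈ Finset.univ.erase j, R m (b m) (a m)) * c' b ≠ 0 →
      labelSupport b = labelSupport a := by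
    intro j b hj hbj h
    ext m
    rw [mem_labelSupport, mem_labelSupport]
    by_cases hm : m = j
    · subst hm; simp [hj, hbj]
    · exact hR m _ _ (Finset.prod_ne_zero_iff.1 (left_ne_zero_of_mul h) m (by simp [hm]))
  by_cases hβ : β = 0
  · subst hβ; exact Or.inl (h0r i _ hi)
  by_cases hne : R i β (a i) = 0
  · exact Or.inl hne
  right
  -- a label of the target group with the same support
  obtain ⟨b, hbi, hb, hsb⟩ : ∃ b, b i = β ∧ c' b ≠ 0 ∧ labelSupport b = labelSupport a := by
    have h1 := mul_ne_zero hne ha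
    rw [hrel i β hi hβ] at h1
    obtain ⟨b, -, h⟩ := Finset.exists_ne_zero_of_sum_ne_zero h1
    rw [ne_eq, ite_eq_right_iff, Classical.not_imp] at h
    obtain ⟨hbi, h⟩ := h
    exact ⟨b, hbi, right_ne_zero_of_mul h, hterm i b hi (hbi ▸ hβ) h⟩
  have hbz : ∀ m, b m ≠ 0 ↔ a m ≠ 0 := fun m => by
    rw [← mem_labelSupport, ← mem_labelSupport, hsb]
  set r : ι → ℝ := fun m => |R m (b m) (a m)| with hr
  have habs : ∀ j, a j ≠ 0 → r j = ∏ m ∈ Finset.univ.erase j, r m := by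
    intro j hj
    have h1 := hrel j (b j) hj ((hbz j).2 hj)
    rw [Finset.sum_eq_single b] at h1
    · rw [if_pos rfl] at h1
      have h2 := congrArg abs h1
      rwa [abs_mul, abs_mul, (hval a).resolve_left ha, (hval' b).resolve_left hb, mul_one, mul_one,
        Finset.abs_prod] at h2
    · intro b2 _ hne2
      by_contra h
      rw [ite_eq_right_iff, Classical.not_imp] at h
      obtain ⟨hb2, h⟩ := h
      have hs2 := hterm j b2 hj (by rw [hb2]; exact (hbz j).2 hj) h
      exact hne2 (eq_of_eq_at hmul' hmin' (right_ne_zero_of_mul h) hb hs2.subset hsb.subset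
        (mem_labelSupport.2 hj) hb2)
    · simp
  have hprod : ∀ j, a j ≠ 0 → ∏ m, r m = r j ^ 2 := by
    intro j hj
    rw [← Finset.mul_prod_erase _ _ (Finset.mem_univ j), ← habs j hj, sq]
  have hrnn : ∀ m, 0 ≤ r m := fun m => abs_nonneg _
  have hri : r i ≠ 0 := by
    rw [hr]; simpa [hbi] using hne
  suffices h : r i = 1 by
    rw [hr] at h; simpa [hbi] using h
  have hsame : ∀ j, a j ≠ 0 → r j = r i := fun j hj =>
    (sq_eq_sq₀ (hrnn j) (hrnn i)).1 (by rw [← hprod j hj, ← hprod i hi])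
  have hpow : ∏ m, r m = r i ^ (labelSupport a).card := by
    rw [← Finset.prod_subset (Finset.subset_univ (labelSupport a))]
    · exact Finset.prod_eq_pow_card fun j hj => hsame j (mem_labelSupport.1 hj)
    · intro m _ hm
      have h1 : a m = 0 := by simpa using hm
      have h2 : b m = 0 := by
        by_contra h; exact (hbz m).1 h h1
      simp [hr, h1, h2, h00]
  have hne0 : labelSupport a ≠ ∅ := Finset.ne_empty_of_mem (mem_labelSupport.2 hi)
  rcases lt_trichotomy (labelSupport a).card 2 with hk | hk | hk
  · have h1 : (labelSupport a).card = 1 := by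
      have := Finset.card_pos.2 (Finset.nonempty_iff_ne_empty.2 hne0)
      omega
    obtain ⟨j, hj⟩ := Finset.card_eq_one.1 h1
    exact (hsingle a j ha hj).elim
  · -- two qubits: `a` is the only label with this support
    have huniq : ∀ a1, c a1 ≠ 0 → labelSupport a1 = labelSupport a → a1 = a := by
      intro a1 ha1 hs1
      by_contra hne1
      have hd := hmul a1 a ha1 ha
      have hsub := labelSupport_labelMul_subset hs1.subset (Finset.Subset.refl (labelSupport a))
      have hdne : labelSupport (fun i => labelMul (a1 i) (a i)) ≠ ∅ := fun h =>
        hne1 (funext fun j => labelMul_eq_zero.1 (labelSupport_eq_empty h j))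
      have hsd : labelSupport (fun i => labelMul (a1 i) (a i)) = labelSupport a := by
        by_contra hn
        exact hdne (hmin _ hd (hsub.ssubset_of_ne hn))
      set d : ι → Fin 4 := fun i => labelMul (a1 i) (a i) with hddef
      have ha1i : a1 i ≠ 0 := by rw [← mem_labelSupport, hs1]; simpa using hi
      have e1 : (fun _ => 0) ≠ a := fun h => hi (congrFun h i).symm
      have e2 : (fun _ => 0) ≠ a1 := fun h => ha1i (congrFun h i).symm
      have e3 : (fun _ => 0) ≠ d := by
        intro h; rw [← h] at hdne; exact hdne hsupp0
      have haux : ∀ x y : Fin 4, x ≠ 0 → y ≠ 0 → labelMul x y ≠ x ∧ labelMul x y ≠ y := by decide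
      have e4 : a ≠ d := fun h => (haux _ _ ha1i hi).2 (congrFun h i).symm
      have e5 : a1 ≠ d := fun h => (haux _ _ ha1i hi).1 (congrFun h i).symm
      have h1 := card_le_sum_sq hval (ω := labelSupport a) {fun _ => 0, a1, a, d} (by
        simp [hzero, ha, ha1, hd, hsupp0, hs1, hsd])
      have h2 := hent _ hne0 (hcu _ hk.le)
      have h3 : ({fun _ => 0, a1, a, d} : Finset (ι → Fin 4)).card = 4 := by
        rw [Finset.card_insert_of_notMem, Finset.card_insert_of_notMem, Finset.card_pair e4] <;>
          simp [e1, e2, e3, e5, hne1]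
      rw [h3] at h1
      rw [hk] at h2
      norm_num at h1 h2
      linarith
    have h1 : c' b = (∏ m, R m (b m) (a m)) * c a := by
      rw [htrans, Finset.sum_eq_single a]
      · intro a1 _ hne1
        by_contra h
        refine hne1 (huniq a1 (right_ne_zero_of_mul h) ?_)
        rw [← hsb]
        ext m
        rw [mem_labelSupport, mem_labelSupport]
        exact (hR m _ _
          (Finset.prod_ne_zero_iff.1 (left_ne_zero_of_mul h) m (Finset.mem_univ m))).symm
      · simp
    have h2 := congrArg abs h1
    rw [abs_mul, (hval a).resolve_left ha, (hval' b).resolve_left hb, mul_one,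
      Finset.abs_prod] at h2
    have h3 := hprod i hi
    rw [← h2] at h3
    exact (pow_eq_one_iff_of_nonneg (hrnn i) two_ne_zero).1 h3.symm
  · rw [hprod i hi] at hpow
    obtain ⟨k, hk'⟩ := Nat.exists_eq_add_of_lt hk
    have h1 : r i ^ (k + 1) = 1 := by
      have h2 : r i ^ 2 * r i ^ (k + 1) = r i ^ 2 * 1 := by
        rw [mul_one, ← pow_add, ← add_assoc, ← hk', ← hpow]
      exact mul_left_cancel₀ (pow_ne_zero 2 hri) h2
    exact (pow_eq_one_iff_of_nonneg (hrnn i) (Nat.succ_ne_zero k)).1 h1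

end

section

lemma pauliMat_zero : pauliMat 0 = 1 := rfl

lemma pauliMat_conjTranspose (a : Fin 4) : (pauliMat a)ᴴ = pauliMat a := by
  fin_cases a <;> ext x y <;> fin_cases x <;> fin_cases y <;> simp [pauliMat]

lemma pauliMat_mul (a b : Fin 4) :
    ∃ s : ℂ, s ≠ 0 ∧ pauliMat a * pauliMat b = s • pauliMat (labelMul a b) := by
  have hI := Complex.I_ne_zero
  have h1 : (1 : ℂ) ≠ 0 := one_ne_zero
  have hI' := neg_ne_zero.2 hI
  refine ⟨![![1, 1, 1, 1], ![1, 1, Complex.I, -Complex.I], ![1, -Complex.I, 1, Complex.I],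
    ![1, Complex.I, -Complex.I, 1]] a b, ?_, ?_⟩
  · fin_cases a <;> fin_cases b <;> simp
  · fin_cases a <;> fin_cases b <;> ext x y <;> fin_cases x <;> fin_cases y <;>
      simp [pauliMat, labelMul, Matrix.mul_apply, Fin.sum_univ_two]

lemma trace_pauliMat_mul (a b : Fin 4) :
    (pauliMat a * pauliMat b).trace = if a = b then 2 else 0 := by
  fin_cases a <;> fin_cases b <;>
    simp [pauliMat, Matrix.trace, Fin.sum_univ_two] <;> norm_num

lemma eq_sum_pauliMat (A : Matrix (Fin 2) (Fin 2) ℂ) :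
    A = ∑ a, ((pauliMat a * A).trace / 2) • pauliMat a := by
  have hI := Complex.I_sq
  ext x y
  fin_cases x <;> fin_cases y <;>
    simp [pauliMat, Fin.sum_univ_four, Matrix.trace, Matrix.mul_apply, Fin.sum_univ_two,
      Matrix.sum_apply] <;> ring_nf <;> simp [hI] <;> ring

lemma sum_pauliMat_mul_pauliMat (x y z w : Fin 2) :
    ∑ a, pauliMat a x y * pauliMat a z w = if y = z ∧ w = x then 2 else 0 := by
  fin_cases x <;> fin_cases y <;> fin_cases z <;> fin_cases w <;>
    simp [pauliMat, Fin.sum_univ_four] <;> norm_num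

/-- The matrix of conjugation by `U` in the Pauli basis. -/
noncomputable def pauliTransfer (U : Matrix (Fin 2) (Fin 2) ℂ) (b a : Fin 4) : ℝ :=
  (pauliMat b * (U * pauliMat a * Uᴴ)).trace.re / 2

lemma pauliTransfer_ofReal (U : Matrix (Fin 2) (Fin 2) ℂ) (b a : Fin 4) :
    (pauliTransfer U b a : ℂ) = (pauliMat b * (U * pauliMat a * Uᴴ)).trace / 2 := by
  have h : (starRingEnd ℂ) (pauliMat b * (U * pauliMat a * Uᴴ)).trace
      = (pauliMat b * (U * pauliMat a * Uᴴ)).trace := by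
    rw [starRingEnd_apply, ← Matrix.trace_conjTranspose]
    simp only [Matrix.conjTranspose_mul, Matrix.conjTranspose_conjTranspose,
      pauliMat_conjTranspose]
    rw [Matrix.trace_mul_comm, Matrix.mul_assoc U]
  rw [pauliTransfer]
  push_cast
  rw [Complex.conj_eq_iff_re.1 h]

lemma conj_pauliMat (U : Matrix (Fin 2) (Fin 2) ℂ) (a : Fin 4) :
    U * pauliMat a * Uᴴ = ∑ b, (pauliTransfer U b a : ℂ) • pauliMat b := by
  simp only [pauliTransfer_ofReal]
  exact eq_sum_pauliMat _

lemma conj_pauliMat' (U : Matrix (Fin 2) (Fin 2) ℂ) (b : Fin 4) :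
    Uᴴ * pauliMat b * U = ∑ a, (pauliTransfer U b a : ℂ) • pauliMat a := by
  simp only [pauliTransfer_ofReal]
  convert eq_sum_pauliMat (Uᴴ * pauliMat b * U) using 4 with a
  rw [Matrix.mul_assoc U, Matrix.trace_mul_comm, ← Matrix.mul_assoc (pauliMat a),
    ← Matrix.mul_assoc (pauliMat a),
    Matrix.trace_mul_comm _ U]
  simp only [Matrix.mul_assoc]

lemma trace_sum_pauliMat_mul (f g : Fin 4 → ℝ) :
    ((∑ a, (f a : ℂ) • pauliMat a) * ∑ b, (g b : ℂ) • pauliMat b).trace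
      = 2 * ((∑ a, f a * g a : ℝ) : ℂ) := by
  simp only [Finset.sum_mul_sum, Matrix.trace_sum, Matrix.smul_mul, Matrix.mul_smul,
    Matrix.trace_smul, trace_pauliMat_mul, smul_eq_mul]
  simp only [mul_ite, mul_zero, Finset.sum_ite_eq, Finset.mem_univ, if_true]
  push_cast
  rw [Finset.mul_sum]
  exact Finset.sum_congr rfl fun a _ => by ring

variable {U : Matrix (Fin 2) (Fin 2) ℂ}

lemma sum_pauliTransfer_mul_col (hU : U ∈ Matrix.unitaryGroup (Fin 2) ℂ) (a a' : Fin 4) :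
    ∑ b, pauliTransfer U b a * pauliTransfer U b a' = if a = a' then 1 else 0 := by
  have hU' : Uᴴ * U = 1 := (Matrix.mem_unitaryGroup_iff').1 hU
  have h1 := trace_sum_pauliMat_mul (fun b => pauliTransfer U b a) (fun b => pauliTransfer U b a')
  rw [← conj_pauliMat, ← conj_pauliMat] at h1
  have h2 : U * pauliMat a * Uᴴ * (U * pauliMat a' * Uᴴ) = U * (pauliMat a * pauliMat a') * Uᴴ := by
    calc _ = U * pauliMat a * (Uᴴ * U) * pauliMat a' * Uᴴ := by simp only [Matrix.mul_assoc]
      _ = _ := by rw [hU']; simp only [Matrix.mul_assoc, Matrix.one_mul]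
  rw [h2, Matrix.trace_mul_comm, ← Matrix.mul_assoc, hU', Matrix.one_mul, trace_pauliMat_mul] at h1
  have h3 : ((∑ b, pauliTransfer U b a * pauliTransfer U b a' : ℝ) : ℂ)
      = ((if a = a' then 1 else 0 : ℝ) : ℂ) := by
    refine mul_left_cancel₀ (two_ne_zero (α := ℂ)) ?_
    rw [← h1]; split_ifs <;> simp
  exact_mod_cast h3

lemma sum_pauliTransfer_mul_row (hU : U ∈ Matrix.unitaryGroup (Fin 2) ℂ) (b b' : Fin 4) :
    ∑ a, pauliTransfer U b a * pauliTransfer U b' a = if b = b' then 1 else 0 := by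
  have hU' : U * Uᴴ = 1 := (Matrix.mem_unitaryGroup_iff).1 hU
  have h1 := trace_sum_pauliMat_mul (fun a => pauliTransfer U b a) (fun a => pauliTransfer U b' a)
  rw [← conj_pauliMat', ← conj_pauliMat'] at h1
  have h2 : Uᴴ * pauliMat b * U * (Uᴴ * pauliMat b' * U) = Uᴴ * (pauliMat b * pauliMat b') * U := by
    calc _ = Uᴴ * pauliMat b * (U * Uᴴ) * pauliMat b' * U := by simp only [Matrix.mul_assoc]
      _ = _ := by rw [hU']; simp only [Matrix.mul_assoc, Matrix.one_mul]
  rw [h2, Matrix.trace_mul_comm, ← Matrix.mul_assoc, hU', Matrix.one_mul, trace_pauliMat_mul] at h1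
  have h3 : ((∑ a, pauliTransfer U b a * pauliTransfer U b' a : ℝ) : ℂ)
      = ((if b = b' then 1 else 0 : ℝ) : ℂ) := by
    refine mul_left_cancel₀ (two_ne_zero (α := ℂ)) ?_
    rw [← h1]; split_ifs <;> simp
  exact_mod_cast h3

lemma pauliTransfer_zero_right (hU : U ∈ Matrix.unitaryGroup (Fin 2) ℂ) (b : Fin 4) :
    pauliTransfer U b 0 = if b = 0 then 1 else 0 := by
  have hU' : U * Uᴴ = 1 := (Matrix.mem_unitaryGroup_iff).1 hU
  have h := pauliTransfer_ofReal U b 0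
  rw [pauliMat_zero, Matrix.mul_one, hU', ← pauliMat_zero, trace_pauliMat_mul] at h
  have h3 : (pauliTransfer U b 0 : ℂ) = ((if b = 0 then 1 else 0 : ℝ) : ℂ) := by
    rw [h]; split_ifs <;> simp
  exact_mod_cast h3

lemma pauliTransfer_zero_left (hU : U ∈ Matrix.unitaryGroup (Fin 2) ℂ) (a : Fin 4) :
    pauliTransfer U 0 a = if a = 0 then 1 else 0 := by
  have hU' : Uᴴ * U = 1 := (Matrix.mem_unitaryGroup_iff').1 hU
  have h := pauliTransfer_ofReal U 0 a
  rw [pauliMat_zero, Matrix.one_mul, Matrix.trace_mul_comm, ← Matrix.mul_assoc, hU',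
    ← pauliMat_zero, trace_pauliMat_mul] at h
  have h3 : (pauliTransfer U 0 a : ℂ) = ((if a = 0 then 1 else 0 : ℝ) : ℂ) := by
    rw [h]; simp only [eq_comm (a := (0 : Fin 4))]; split_ifs <;> simp
  exact_mod_cast h3

/-- A unitary which permutes two of the Pauli matrices up to sign is a Clifford operation. -/
lemma isClifford_of_two_columns (hU : U ∈ Matrix.unitaryGroup (Fin 2) ℂ) {a a' : Fin 4}
    (ha : a ≠ 0) (ha' : a' ≠ 0) (hne : a ≠ a')
    (hcol : ∀ b, pauliTransfer U b a = 0 ∨ |pauliTransfer U b a| = 1)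
    (hcol' : ∀ b, pauliTransfer U b a' = 0 ∨ |pauliTransfer U b a'| = 1) : IsClifford U := by
  set R := pauliTransfer U with hR
  have hsq : ∀ t : ℝ, (t = 0 ∨ |t| = 1) ↔ (t ^ 2 = 0 ∨ t ^ 2 = 1) := by
    intro t
    rw [← sq_abs t, pow_eq_one_iff_of_nonneg (abs_nonneg t) two_ne_zero]; simp
  have hrow : ∀ b, ∑ k, R b k ^ 2 = 1 := fun b => by
    simpa [sq] using sum_pauliTransfer_mul_row hU b b
  have hcl : ∀ k, ∑ b, R b k ^ 2 = 1 := fun k => by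
    simpa [sq] using sum_pauliTransfer_mul_col hU k k
  have hall : ∀ k b, R b k = 0 ∨ |R b k| = 1 := by
    intro k b
    have h0 : R b 0 ^ 2 = 0 ∨ R b 0 ^ 2 = 1 := by
      rw [hR, pauliTransfer_zero_right hU]; split_ifs <;> simp
    have h1 := (hsq _).1 (hcol b)
    have h2 := (hsq _).1 (hcol' b)
    have h3 := hrow b
    rw [hsq]
    by_cases hk0 : k = 0
    · subst hk0; exact h0
    by_cases hka : k = a
    · subst hka; exact h1
    by_cases hka' : k = a'
    · subst hka'; exact h2
    have h4 : ∑ k, R b k ^ 2 = R b 0 ^ 2 + R b a ^ 2 + R b a' ^ 2 + R b k ^ 2 := by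
      have h5 : (Finset.univ : Finset (Fin 4)) = {0, a, a', k} := by
        clear * - ha ha' hne hk0 hka hka'
        revert a a' k; decide
      rw [h5, Finset.sum_insert, Finset.sum_insert, Finset.sum_insert, Finset.sum_singleton]
      · ring
      all_goals simp [eq_comm, *]
      all_goals tauto
    rw [h3] at h4
    have h6 := sq_nonneg (R b k)
    rcases h0 with h0 | h0 <;> rcases h1 with h1 | h1 <;> rcases h2 with h2 | h2 <;>
      rw [h0, h1, h2] at h4
    all_goals first
      | exact Or.inr (by linarith)
      | exact Or.inl (by linarith)
  have hone : ∀ f : Fin 4 → ℝ, ∑ k, f k ^ 2 = 1 → ∀ k, |f k| = 1 → ∀ k', k' ≠ k → f k' = 0 := by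
    intro f hf k hk k' hk'
    have h1 := Finset.add_le_sum (f := fun k => f k ^ 2) (fun i _ => sq_nonneg (f i))
      (Finset.mem_univ k') (Finset.mem_univ k) hk'
    rw [hf, ← sq_abs (f k), hk] at h1
    have h2 := sq_nonneg (f k')
    exact pow_eq_zero_iff (two_ne_zero) |>.1 (by linarith)
  have hex : ∀ u : Fin 3, ∃ v : Fin 3, |R v.succ u.succ| = 1 := by
    intro u
    by_contra! h
    have h1 := hcl u.succ
    rw [Fin.sum_univ_succ, hR, pauliTransfer_zero_left hU, ← hR, if_neg (Fin.succ_ne_zero u),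
      Finset.sum_eq_zero] at h1
    · norm_num at h1
    · intro v _
      rw [(hall _ _).resolve_right (h v)]; norm_num
  choose π hπ using hex
  have hinj : Function.Injective π := by
    intro u u' h
    by_contra hn
    have h1 : R (π u).succ u'.succ = 0 := hone _ (hrow _) u.succ (hπ u) u'.succ
      (fun h => hn (Fin.succ_injective _ h).symm)
    have h2 := hπ u'
    rw [← h] at h2
    rw [h1] at h2
    norm_num at h2
  refine ⟨hU, Equiv.ofBijective π (Finite.injective_iff_bijective.1 hinj), fun u => ?_⟩
  refine ⟨R (π u).succ u.succ, ?_, ?_⟩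
  · rcases (abs_eq zero_le_one).1 (hπ u) with h | h <;> simp [h]
  · rw [conj_pauliMat, Finset.sum_eq_single (π u).succ]
    · rfl
    · intro b _ hb
      have : R b u.succ = 0 := hone (fun k => R k u.succ) (hcl _) _ (hπ u) b hb
      rw [← hR, this]; simp
    · simp

end

section

variable {ι : Type} [Fintype ι] [DecidableEq ι]

lemma kron_mul (A B : ι → Matrix (Fin 2) (Fin 2) ℂ) :
    kron A * kron B = kron fun i => A i * B i := by
  ext x y
  simp only [kron, Matrix.mul_apply, Matrix.of_apply, ← Finset.prod_mul_distrib]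
  exact sum_prod_eq_prod_sum fun i k => A i (x i) k * B i k (y i)

omit [DecidableEq ι] in
lemma kron_conjTranspose (A : ι → Matrix (Fin 2) (Fin 2) ℂ) :
    (kron A)ᴴ = kron fun i => (A i)ᴴ := by
  ext x y
  simp [kron, Matrix.conjTranspose_apply]

omit [DecidableEq ι] in
lemma kron_one : kron (fun _ : ι => (1 : Matrix (Fin 2) (Fin 2) ℂ)) = 1 := by
  ext x y
  simp [kron, Matrix.one_apply, Finset.prod_boole, funext_iff]

omit [DecidableEq ι] in
lemma kron_smul (s : ι → ℂ) (A : ι → Matrix (Fin 2) (Fin 2) ℂ) :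
    kron (fun i => s i • A i) = (∏ i, s i) • kron A := by
  ext x y
  simp [kron, Finset.prod_mul_distrib]

lemma kron_sum_smul {κ : Type} [Fintype κ] (f : ι → κ → ℂ) (P : κ → Matrix (Fin 2) (Fin 2) ℂ) :
    kron (fun i => ∑ k, f i k • P k)
      = ∑ a : ι → κ, (∏ i, f i (a i)) • kron fun i => P (a i) := by
  ext x y
  simp only [kron, Matrix.of_apply, Matrix.sum_apply, Matrix.smul_apply, smul_eq_mul,
    ← Finset.prod_mul_distrib]
  exact (sum_prod_eq_prod_sum fun i k => f i k * P k (x i) (y i)).symm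

lemma trace_kron (A : ι → Matrix (Fin 2) (Fin 2) ℂ) : (kron A).trace = ∏ i, (A i).trace := by
  simp only [Matrix.trace, kron, Matrix.diag_apply, Matrix.of_apply]
  exact sum_prod_eq_prod_sum fun i k => A i k k

/-- The Pauli operator with a given label and phase `1`. -/
noncomputable def pauliKron (a : ι → Fin 4) : Matrix (ι → Fin 2) (ι → Fin 2) ℂ :=
  kron fun i => pauliMat (a i)

omit [DecidableEq ι] in
lemma pauliKron_conjTranspose (a : ι → Fin 4) : (pauliKron a)ᴴ = pauliKron a := by
  simp only [pauliKron, kron_conjTranspose, pauliMat_conjTranspose]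

lemma pauliKron_mul (a b : ι → Fin 4) : ∃ s : ℂ, s ≠ 0 ∧
    pauliKron a * pauliKron b = s • pauliKron fun i => labelMul (a i) (b i) := by
  choose s hs h using fun i => pauliMat_mul (a i) (b i)
  refine ⟨∏ i, s i, Finset.prod_ne_zero_iff.2 fun i _ => hs i, ?_⟩
  simp only [pauliKron, kron_mul, h, kron_smul]

lemma eq_of_smul_pauliKron_eq {a b : ι → Fin 4} {s t : ℂ} (hs : s ≠ 0)
    (h : s • pauliKron a = t • pauliKron b) : a = b := by
  by_contra hne
  obtain ⟨i, hi⟩ := Function.ne_iff.1 hne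
  have h1 := congrArg (fun A => (pauliKron a * A).trace) h
  simp only [Matrix.mul_smul, Matrix.trace_smul, pauliKron, kron_mul, trace_kron,
    trace_pauliMat_mul, smul_eq_mul] at h1
  have hz : ∏ i, (if a i = b i then (2 : ℂ) else 0) = 0 :=
    Finset.prod_eq_zero (Finset.mem_univ i) (if_neg hi)
  rw [hz] at h1
  simp [hs] at h1

/-- The expectation value of a Pauli operator. -/
noncomputable def pauliExp (ψ : (ι → Fin 2) → ℂ) (a : ι → Fin 4) : ℝ :=
  (star ψ ⬝ᵥ (pauliKron a *ᵥ ψ)).re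

lemma pauliExp_ofReal (ψ : (ι → Fin 2) → ℂ) (a : ι → Fin 4) :
    (pauliExp ψ a : ℂ) = star ψ ⬝ᵥ (pauliKron a *ᵥ ψ) := by
  rw [pauliExp]
  refine Complex.conj_eq_iff_re.1 ?_
  rw [starRingEnd_apply, ← Matrix.star_dotProduct, Matrix.star_mulVec, pauliKron_conjTranspose,
    ← Matrix.dotProduct_mulVec]

lemma pauliExp_kron_mulVec {U : ι → Matrix (Fin 2) (Fin 2) ℂ}
    (ψ : (ι → Fin 2) → ℂ) (b : ι → Fin 4) :
    pauliExp (kron U *ᵥ ψ) b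
      = ∑ a, (∏ i, pauliTransfer (U i) (b i) (a i)) * pauliExp ψ a := by
  have h1 : (kron U)ᴴ * pauliKron b * kron U
      = ∑ a, (∏ i, (pauliTransfer (U i) (b i) (a i) : ℂ)) • pauliKron a := by
    simp only [pauliKron, kron_conjTranspose, kron_mul, conj_pauliMat', kron_sum_smul]
  have h2 : ((pauliExp (kron U *ᵥ ψ) b : ℝ) : ℂ)
      = ((∑ a, (∏ i, pauliTransfer (U i) (b i) (a i)) * pauliExp ψ a : ℝ) : ℂ) := by
    push_cast
    simp only [pauliExp_ofReal]
    rw [Matrix.star_mulVec, ← Matrix.dotProduct_mulVec, Matrix.mulVec_mulVec,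
      Matrix.mulVec_mulVec, h1, Matrix.sum_mulVec, dotProduct_sum]
    simp only [Matrix.smul_mulVec, dotProduct_smul, smul_eq_mul]
  exact_mod_cast h2

lemma sum_normSq_eq (ψ : (ι → Fin 2) → ℂ) :
    ((∑ x, Complex.normSq (ψ x) : ℝ) : ℂ) = star ψ ⬝ᵥ ψ := by
  push_cast
  exact Finset.sum_congr rfl fun x _ => by
    rw [Complex.normSq_eq_conj_mul_self]; rfl

/-- The total squared weight of the Pauli operators supported in `ω`, as the expectation of the
swap of the qubits of `ω` between two copies of the state. -/
lemma sum_pauliExp_sq (ψ : (ι → Fin 2) → ℂ) (ω : Finset ι) :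
    ((∑ a with labelSupport a ⊆ ω, pauliExp ψ a ^ 2 : ℝ) : ℂ)
      = 2 ^ ω.card * ∑ x, ∑ z, star (ψ x) * star (ψ z) *
          (ψ (ω.piecewise z x) * ψ (ω.piecewise x z)) := by
  have hexp : ∀ a, (pauliExp ψ a : ℂ) = ∑ x, ∑ y, star (ψ x) * ψ y *
      ∏ i, pauliMat (a i) (x i) (y i) := by
    intro a
    rw [pauliExp_ofReal]
    simp only [dotProduct, Matrix.mulVec, Finset.mul_sum, Pi.star_apply]
    refine Finset.sum_congr rfl fun x _ => Finset.sum_congr rfl fun y _ => ?_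
    simp only [pauliKron, kron, Matrix.of_apply]
    ring
  have hsum : ∀ x y z w : ι → Fin 2, ∑ a with labelSupport a ⊆ ω,
      ∏ i, (pauliMat (a i) (x i) (y i) * pauliMat (a i) (z i) (w i))
      = if y = ω.piecewise z x ∧ w = ω.piecewise x z then (2 : ℂ) ^ ω.card else 0 := by
    intro x y z w
    have h1 : ∑ a with labelSupport a ⊆ ω,
        ∏ i, (pauliMat (a i) (x i) (y i) * pauliMat (a i) (z i) (w i))
        = ∑ a : ι → Fin 4, ∏ i, if i ∈ ω ∨ a i = 0 then
          pauliMat (a i) (x i) (y i) * pauliMat (a i) (z i) (w i) else 0 := by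
      rw [Finset.sum_filter]
      refine Finset.sum_congr rfl fun a _ => ?_
      split_ifs with h
      · refine Finset.prod_congr rfl fun i _ => (if_pos ?_).symm
        by_contra! hi
        exact hi.1 (h (mem_labelSupport.2 hi.2))
      · obtain ⟨i, hi, hiω⟩ := Finset.not_subset.1 h
        refine (Finset.prod_eq_zero (Finset.mem_univ i) (if_neg ?_)).symm
        rw [mem_labelSupport] at hi
        tauto
    rw [h1, sum_prod_eq_prod_sum (fun i α => if i ∈ ω ∨ α = 0 then
          pauliMat α (x i) (y i) * pauliMat α (z i) (w i) else 0)]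
    have h2 : ∀ i, (∑ α, if i ∈ ω ∨ α = 0 then
          pauliMat α (x i) (y i) * pauliMat α (z i) (w i) else 0)
        = (if i ∈ ω then 2 else 1) *
          if y i = ω.piecewise z x i ∧ w i = ω.piecewise x z i then 1 else 0 := by
      intro i
      by_cases hi : i ∈ ω
      · simp [hi, sum_pauliMat_mul_pauliMat]
      · simp only [hi, false_or, Finset.sum_ite_eq', Finset.mem_univ, if_true, pauliMat_zero,
          Matrix.one_apply, Finset.piecewise_eq_of_notMem, not_false_eq_true, if_false,
          ite_and, eq_comm (a := y i), eq_comm (a := w i)]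
        split_ifs <;> simp
    simp only [h2, Finset.prod_mul_distrib, Finset.prod_boole, Finset.prod_ite, Finset.prod_const,
      Finset.filter_mem_eq_inter, Finset.univ_inter]
    simp only [funext_iff, Finset.mem_univ, true_implies, forall_and, one_pow, mul_ite, mul_one,
      mul_zero]
  push_cast
  calc ∑ a with labelSupport a ⊆ ω, (pauliExp ψ a : ℂ) ^ 2
      = ∑ a with labelSupport a ⊆ ω, ∑ p : (ι → Fin 2) × (ι → Fin 2),
          ∑ q : (ι → Fin 2) × (ι → Fin 2), (star (ψ p.1) * ψ p.2) * (star (ψ q.1) * ψ q.2) *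
          ∏ i, (pauliMat (a i) (p.1 i) (p.2 i) * pauliMat (a i) (q.1 i) (q.2 i)) := by
        refine Finset.sum_congr rfl fun a _ => ?_
        rw [hexp, ← Fintype.sum_prod_type' (f := fun x y => star (ψ x) * ψ y *
          ∏ i, pauliMat (a i) (x i) (y i)), sq, Finset.sum_mul_sum]
        refine Finset.sum_congr rfl fun p _ => Finset.sum_congr rfl fun q _ => ?_
        rw [Finset.prod_mul_distrib]
        ring
    _ = ∑ p : (ι → Fin 2) × (ι → Fin 2), ∑ q : (ι → Fin 2) × (ι → Fin 2),
          (star (ψ p.1) * ψ p.2) * (star (ψ q.1) * ψ q.2) *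
          if p.2 = ω.piecewise q.1 p.1 ∧ q.2 = ω.piecewise p.1 q.1 then (2 : ℂ) ^ ω.card
          else 0 := by
        rw [Finset.sum_comm]
        refine Finset.sum_congr rfl fun p _ => ?_
        rw [Finset.sum_comm]
        refine Finset.sum_congr rfl fun q _ => ?_
        rw [← Finset.mul_sum, hsum]
    _ = _ := by
        simp only [Fintype.sum_prod_type, Finset.mul_sum]
        refine Finset.sum_congr rfl fun x _ => ?_
        rw [Finset.sum_comm]
        refine Finset.sum_congr rfl fun z _ => ?_
        rw [Finset.sum_eq_single (ω.piecewise z x), Finset.sum_eq_single (ω.piecewise x z)]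
        · rw [if_pos ⟨rfl, rfl⟩]; ring
        · intro w _ hw; rw [if_neg (fun h => hw h.2), mul_zero]
        · simp
        · intro y _ hy
          exact Finset.sum_eq_zero fun w _ => by rw [if_neg (fun h => hy h.1), mul_zero]
        · simp

lemma sum_pauliExp_sq_univ {ψ : (ι → Fin 2) → ℂ} (hψ : ∑ x, Complex.normSq (ψ x) = 1) :
    ∑ a, pauliExp ψ a ^ 2 = 2 ^ Fintype.card ι := by
  have h := sum_pauliExp_sq ψ Finset.univ
  have h1 := sum_normSq_eq ψ
  rw [hψ] at h1
  have h2 : ∑ x, ∑ z, star (ψ x) * star (ψ z) * (ψ z * ψ x) = (star ψ ⬝ᵥ ψ) * (star ψ ⬝ᵥ ψ) := by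
    simp only [dotProduct, Finset.sum_mul_sum, Pi.star_apply]
    exact Finset.sum_congr rfl fun x _ => Finset.sum_congr rfl fun z _ => by ring
  simp only [Finset.subset_univ, Finset.filter_true, Finset.piecewise_univ, h2, ← h1,
    Finset.card_univ] at h
  have h3 : ((∑ a, pauliExp ψ a ^ 2 : ℝ) : ℂ) = ((2 ^ Fintype.card ι : ℝ) : ℂ) := by
    rw [h]; simp
  exact_mod_cast h3

lemma sum_pauliExp_sq_lt {ψ : (ι → Fin 2) → ℂ} (hψ : ∑ x, Complex.normSq (ψ x) = 1)
    (hent : FullyEntangled ψ) {ω : Finset ι} (h0 : ω ≠ ∅) (h1 : ω ≠ Finset.univ) :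
    ∑ a with labelSupport a ⊆ ω, pauliExp ψ a ^ 2 < 2 ^ ω.card := by
  by_contra! hge
  refine hent ?_
  have hT : 1 ≤ ∑ p : (ι → Fin 2) × (ι → Fin 2),
      (ψ (ω.piecewise p.2 p.1) * ψ (ω.piecewise p.1 p.2) *
        (starRingEnd ℂ) (ψ p.1 * ψ p.2)).re := by
    have h2 := congrArg Complex.re (sum_pauliExp_sq ψ ω)
    have h3 : ∑ x, ∑ z, star (ψ x) * star (ψ z) * (ψ (ω.piecewise z x) * ψ (ω.piecewise x z))
        = ∑ p : (ι → Fin 2) × (ι → Fin 2),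
      (ψ (ω.piecewise p.2 p.1) * ψ (ω.piecewise p.1 p.2) * (starRingEnd ℂ) (ψ p.1 * ψ p.2)) := by
      rw [Fintype.sum_prod_type]
      refine Finset.sum_congr rfl fun x _ => Finset.sum_congr rfl fun z _ => ?_
      rw [map_mul, mul_comm]; rfl
    have h4 : ((2 : ℂ) ^ ω.card) = ((2 ^ ω.card : ℝ) : ℂ) := by push_cast; rfl
    rw [h3, h4, Complex.re_ofReal_mul, Complex.ofReal_re, Complex.re_sum] at h2
    rw [h2] at hge
    exact (le_mul_iff_one_le_right (by positivity)).1 hge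
  have hunit : ∑ p : (ι → Fin 2) × (ι → Fin 2), Complex.normSq (ψ p.1 * ψ p.2) = 1 := by
    simp only [Complex.normSq_mul, Fintype.sum_prod_type]
    rw [← Finset.sum_mul_sum, hψ, one_mul]
  have hinv : Function.Involutive (fun p : (ι → Fin 2) × (ι → Fin 2) =>
      (ω.piecewise p.2 p.1, ω.piecewise p.1 p.2)) := by
    rintro ⟨x, z⟩
    ext i <;> by_cases hi : i ∈ ω <;> simp [hi]
  have hunit' : ∑ p : (ι → Fin 2) × (ι → Fin 2),
      Complex.normSq (ψ (ω.piecewise p.2 p.1) * ψ (ω.piecewise p.1 p.2)) = 1 := by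
    rw [← hunit]
    exact Equiv.sum_comp (hinv.toPerm _)
      fun p : (ι → Fin 2) × (ι → Fin 2) => Complex.normSq (ψ p.1 * ψ p.2)
  have hle : ∑ p : (ι → Fin 2) × (ι → Fin 2), Complex.normSq
      (ψ (ω.piecewise p.2 p.1) * ψ (ω.piecewise p.1 p.2) - ψ p.1 * ψ p.2) ≤ 0 := by
    simp only [Complex.normSq_sub, Finset.sum_sub_distrib, Finset.sum_add_distrib, hunit, hunit',
      ← Finset.mul_sum]
    linarith
  have hswap : ∀ x z, ψ (ω.piecewise z x) * ψ (ω.piecewise x z) = ψ x * ψ z := by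
    intro x z
    have h2 := (Finset.sum_eq_zero_iff_of_nonneg fun p _ => Complex.normSq_nonneg _).1
      (le_antisymm hle (Finset.sum_nonneg fun p _ => Complex.normSq_nonneg _)) (x, z)
      (Finset.mem_univ _)
    exact sub_eq_zero.1 (Complex.normSq_eq_zero.1 h2)
  obtain ⟨p, hp⟩ : ∃ p, ψ p ≠ 0 := by
    by_contra! h
    simp [h] at hψ
  refine ⟨ω, fun x => ψ (mergeAssign ω x fun i => p i.1),
    fun z => ψ (mergeAssign ω (fun i => p i.1) z) / ψ p, h0, h1, fun x => ?_⟩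
  have hm : ∀ u v : ι → Fin 2, mergeAssign ω (fun i => u i.1) (fun i => v i.1)
      = ω.piecewise u v := by
    intro u v; ext i; by_cases hi : i ∈ ω <;> simp [mergeAssign, hi]
  beta_reduce
  rw [hm, hm, ← mul_div_assoc, mul_comm, hswap, mul_div_cancel_right₀ _ hp]

variable {S : Stabilizer ι} {ψ : (ι → Fin 2) → ℂ}

omit [Fintype ι] [DecidableEq ι] in
lemma PauliOp.phase_ne_zero (M : PauliOp ι) : M.phase ≠ 0 := by
  rcases M.phase_ok with h | h | h | h <;> simp [h]

omit [Fintype ι] [DecidableEq ι] in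
lemma PauliOp.norm_phase (M : PauliOp ι) : ‖M.phase‖ = 1 := by
  rcases M.phase_ok with h | h | h | h <;> simp [h]

lemma stabilizesState.ne_zero (hψ : stabilizesState S ψ) : ψ ≠ 0 := by
  rintro rfl
  simpa using hψ.1

lemma stabilizesState.dotProduct_self (hψ : stabilizesState S ψ) : star ψ ⬝ᵥ ψ = 1 := by
  rw [← sum_normSq_eq, hψ.1, Complex.ofReal_one]

lemma stabilizesState.pauliKron_mulVec (hψ : stabilizesState S ψ) {M : PauliOp ι}
    (hM : M ∈ S.elems) : pauliKron M.label *ᵥ ψ = M.phase⁻¹ • ψ := by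
  have h := hψ.2 M hM
  rw [PauliOp.toMatrix, Matrix.smul_mulVec] at h
  rw [eq_inv_smul_iff₀ M.phase_ne_zero]
  exact h

lemma stabilizesState.abs_pauliExp (hψ : stabilizesState S ψ) {M : PauliOp ι}
    (hM : M ∈ S.elems) : |pauliExp ψ M.label| = 1 := by
  have h := pauliExp_ofReal ψ M.label
  rw [hψ.pauliKron_mulVec hM, dotProduct_smul, hψ.dotProduct_self, smul_eq_mul, mul_one] at h
  rw [← Real.norm_eq_abs, ← Complex.norm_real, h, norm_inv, M.norm_phase, inv_one]

lemma stabilizesState.label_injOn (hψ : stabilizesState S ψ) :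
    Set.InjOn PauliOp.label (S.elems : Set (PauliOp ι)) := by
  intro M hM N hN h
  have h1 := hψ.pauliKron_mulVec hM
  rw [h, hψ.pauliKron_mulVec hN] at h1
  have h2 := inv_injective (smul_left_injective ℂ hψ.ne_zero h1)
  cases M; cases N; simp_all

lemma stabilizesState.pauliExp_ne_zero_iff (hψ : stabilizesState S ψ) {a : ι → Fin 4} :
    pauliExp ψ a ≠ 0 ↔ ∃ M ∈ S.elems, M.label = a := by
  constructor
  · intro ha
    by_contra! hn
    have h1 : ∑ b ∈ S.elems.image PauliOp.label, pauliExp ψ b ^ 2 = 2 ^ Fintype.card ι := by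
      rw [Finset.sum_image hψ.label_injOn, Finset.sum_congr rfl fun M hM => by
        rw [← sq_abs, hψ.abs_pauliExp hM, one_pow]]
      simp [S.card_elems]
    have h2 := Finset.sum_le_sum_of_subset_of_nonneg
      (Finset.subset_univ (insert a (S.elems.image PauliOp.label)))
      (f := fun b => pauliExp ψ b ^ 2) fun _ _ _ => sq_nonneg _
    rw [Finset.sum_insert (by simpa using hn), h1, sum_pauliExp_sq_univ hψ.1] at h2
    have : 0 < pauliExp ψ a ^ 2 := by positivity
    linarith
  · rintro ⟨M, hM, rfl⟩ h
    have := hψ.abs_pauliExp hM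
    simp [h] at this

lemma stabilizesState.pauliExp_eq_zero_or (hψ : stabilizesState S ψ) (a : ι → Fin 4) :
    pauliExp ψ a = 0 ∨ |pauliExp ψ a| = 1 := by
  by_cases h : pauliExp ψ a = 0
  · exact Or.inl h
  · obtain ⟨M, hM, rfl⟩ := hψ.pauliExp_ne_zero_iff.1 h
    exact Or.inr (hψ.abs_pauliExp hM)

lemma stabilizesState.pauliExp_labelMul_ne_zero (hψ : stabilizesState S ψ) (a b : ι → Fin 4)
    (ha : pauliExp ψ a ≠ 0) (hb : pauliExp ψ b ≠ 0) :
    pauliExp ψ (fun i => labelMul (a i) (b i)) ≠ 0 := by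
  obtain ⟨M, hM, rfl⟩ := hψ.pauliExp_ne_zero_iff.1 ha
  obtain ⟨N, hN, rfl⟩ := hψ.pauliExp_ne_zero_iff.1 hb
  obtain ⟨s, hs, h⟩ := pauliKron_mul M.label N.label
  have h1 := congrArg (fun A => star ψ ⬝ᵥ (A *ᵥ ψ)) h
  simp only [← Matrix.mulVec_mulVec, hψ.pauliKron_mulVec hN, hψ.pauliKron_mulVec hM,
    Matrix.mulVec_smul, Matrix.smul_mulVec, dotProduct_smul, hψ.dotProduct_self,
    ← pauliExp_ofReal, smul_eq_mul, mul_one] at h1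
  intro h2
  rw [h2] at h1
  simp [M.phase_ne_zero, N.phase_ne_zero] at h1

/-- If the minimal elements only involve one Pauli matrix at a qubit, so does the subgroup they
generate. -/
lemma inMinimalSubgroup.label_eq {i : ι} {v : Fin 4}
    (h : ∀ M ∈ S.elems, IsMinimalSupport S M.support → M.label i = 0 ∨ M.label i = v)
    {M : PauliOp ι} (hM : inMinimalSubgroup S M) : M.label i = 0 ∨ M.label i = v := by
  have key : ∀ A ∈ Submonoid.closure (minimalMatrices S),
      ∃ (s : ℂ) (a : ι → Fin 4), s ≠ 0 ∧ A = s • pauliKron a ∧ (a i = 0 ∨ a i = v) := by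
    intro A hA
    induction hA using Submonoid.closure_induction with
    | mem A hA =>
      obtain ⟨N, hN, hmin, rfl⟩ := hA
      exact ⟨N.phase, N.label, N.phase_ne_zero, rfl, h N hN hmin⟩
    | one =>
      refine ⟨1, fun _ => 0, one_ne_zero, ?_, Or.inl rfl⟩
      rw [one_smul]
      exact kron_one.symm
    | mul A B _ _ hA hB =>
      obtain ⟨s, a, hs, rfl, ha⟩ := hA
      obtain ⟨t, b, ht, rfl, hb⟩ := hB
      obtain ⟨r, hr, hab⟩ := pauliKron_mul a b
      refine ⟨s * t * r, fun i => labelMul (a i) (b i), mul_ne_zero (mul_ne_zero hs ht) hr,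
        ?_, ?_⟩
      · rw [Matrix.smul_mul, Matrix.mul_smul, hab, smul_smul, smul_smul, mul_assoc]
      · have aux : ∀ v x y : Fin 4, (x = 0 ∨ x = v) → (y = 0 ∨ y = v) →
            labelMul x y = 0 ∨ labelMul x y = v := by decide
        exact aux v _ _ ha hb
  obtain ⟨s, a, hs, hA, ha⟩ := key _ hM.2
  rwa [← eq_of_smul_pauliKron_eq hs (hA.symm.trans rfl : s • pauliKron a = M.phase • pauliKron _)]

end

/-- If `ψ` is a fully entangled stabilizer state on `n ≥ 3` qubits such
that all three Pauli matrices `σₓ, σ_y, σ_z` occur on every qubit in the subgroup `ℳ(ψ)`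
generated by the minimal elements of `𝒮(ψ)`, then `LU(ψ) = LC(ψ)`. -/
theorem stmt_0 {n : ℕ} (hn : 3 ≤ n) (S : Stabilizer (Fin n)) (ψ : (Fin n → Fin 2) → ℂ)
    (hψ : stabilizesState S ψ) (hent : FullyEntangled ψ)
    (hmin : ∀ i : Fin n, ∀ u : Fin 4, u ≠ 0 →
      ∃ M : PauliOp (Fin n), inMinimalSubgroup S M ∧ M.label i = u) :
    ∀ φ : (Fin n → Fin 2) → ℂ, IsStabilizerState φ → (LUequiv ψ φ ↔ LCequiv ψ φ) := by
  intro φ hφ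
  refine ⟨?_, fun ⟨U, hU, h⟩ => ⟨U, fun i => (hU i).1, h⟩⟩
  rintro ⟨U, hU, rfl⟩
  obtain ⟨S', hφ⟩ := hφ
  refine ⟨U, fun i => ?_, rfl⟩
  have hcol : ∀ M ∈ S.elems, IsMinimalSupport S M.support → M.label i ≠ 0 → ∀ β,
      pauliTransfer (U i) β (M.label i) = 0 ∨ |pauliTransfer (U i) β (M.label i)| = 1 := by
    intro M hM hMmin hMi β
    refine eq_zero_or_abs_eq_one_of_minimal (R := fun i => pauliTransfer (U i))
      (c := pauliExp ψ) (c' := pauliExp (kron U *ᵥ ψ)) (by simpa using hn)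
      (fun i => sum_pauliTransfer_mul_col (hU i))
      (fun i => by rw [pauliTransfer_zero_right (hU i), if_pos rfl])
      (fun i β h => by rw [pauliTransfer_zero_right (hU i), if_neg h])
      (fun i α h => by rw [pauliTransfer_zero_left (hU i), if_neg h])
      (pauliExp_kron_mulVec ψ) hψ.pauliExp_eq_zero_or hφ.pauliExp_eq_zero_or
      hψ.pauliExp_labelMul_ne_zero hφ.pauliExp_labelMul_ne_zero
      (fun ω h0 h1 => sum_pauliExp_sq_lt hψ.1 hent h0 h1)
      (hψ.pauliExp_ne_zero_iff.2 ⟨M, hM, rfl⟩) ?_ hMi β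
    intro a ha hs
    obtain ⟨N, hN, rfl⟩ := hψ.pauliExp_ne_zero_iff.1 ha
    exact hMmin.2 N hN hs
  have hex : ∀ v u : Fin 4, u ≠ 0 → u ≠ v → ∃ M ∈ S.elems, IsMinimalSupport S M.support ∧
      M.label i ≠ 0 ∧ M.label i ≠ v := by
    intro v u hu huv
    by_contra! h
    obtain ⟨M, hM, hMu⟩ := hmin i u hu
    have := hM.label_eq (i := i) (v := v) fun N hN hNmin => by
      by_cases h0 : N.label i = 0
      · exact Or.inl h0
      · exact Or.inr (h N hN hNmin h0)
    rw [hMu] at this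
    tauto
  obtain ⟨M, hM, hMmin, hM0, -⟩ := hex 0 1 (by decide) (by decide)
  obtain ⟨u, hu, huv⟩ : ∃ u : Fin 4, u ≠ 0 ∧ u ≠ M.label i := by
    generalize M.label i = v
    revert v; decide
  obtain ⟨N, hN, hNmin, hN0, hNM⟩ := hex (M.label i) u hu huv
  exact isClifford_of_two_columns (hU i) hM0 hN0 hNM.symm (hcol M hM hMmin hM0)
    (hcol N hN hNmin hN0)
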